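/- For every integer k ≥ 0 and n = 4k + 1, the star graph on 3(n²−1)/8 + n = 6k² + 7k + 1 vertices is a vertex-minor of the n×n grid graph. -/

import Mathlib

/-- A finite simple graph with an explicit vertex set inside an ambient type `α`. -/
structure FGraph (α : Type*) where
  verts : Set α
  Adj : α → α → Prop
  symm : ∀ {a b}, Adj a b → Adj b a
  loopless : ∀ a, ¬ Adj a a
  edge_mem : ∀ {a b}, Adj a b → a ∈ verts ∧ b ∈ verts

namespace FGraph

variable {α : Type*}

/-- Local complementation at `v`: two distinct vertices are adjacent iff exactly one of
(adjacent in `G`) or (both neighbours of `v` in `G`) holds. -/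
def LC (G : FGraph α) (v : α) : FGraph α where
  verts := G.verts
  Adj a b := a ≠ b ∧ Xor' (G.Adj a b) (G.Adj v a ∧ G.Adj v b)
  symm := by
    rintro a b ⟨hne, h⟩
    refine ⟨hne.symm, ?_⟩
    rcases h with ⟨h1, h2⟩ | ⟨h1, h2⟩
    · exact Or.inl ⟨G.symm h1, fun hx => h2 ⟨hx.2, hx.1⟩⟩
    · exact Or.inr ⟨⟨h1.2, h1.1⟩, fun hx => h2 (G.symm hx)⟩
  loopless := fun a h => h.1 rfl
  edge_mem := by
    rintro a b ⟨hne, h⟩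
    rcases h with ⟨h1, _⟩ | ⟨⟨ha, hb⟩, _⟩
    · exact G.edge_mem h1
    · exact ⟨(G.edge_mem ha).2, (G.edge_mem hb).2⟩

/-- Z measurement at `v`: delete the vertex `v` together with all incident edges. -/
def ZM (G : FGraph α) (v : α) : FGraph α where
  verts := G.verts \ {v}
  Adj a b := G.Adj a b ∧ a ≠ v ∧ b ≠ v
  symm := fun h => ⟨G.symm h.1, h.2.2, h.2.1⟩
  loopless := fun a h => G.loopless a h.1
  edge_mem := by
    rintro a b ⟨h, ha, hb⟩
    exact ⟨⟨(G.edge_mem h).1, ha⟩, ⟨(G.edge_mem h).2, hb⟩⟩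

/-- X measurement at `u` with chosen neighbour `w`:
`X_u(G) = LC_w(Z_u(LC_u(LC_w(G))))`. -/
def XM (G : FGraph α) (u w : α) : FGraph α :=
  ((((G.LC w).LC u).ZM u).LC w)

/-- Y measurement at `v`: `Y_v(G) = Z_v(LC_v(G))`. -/
def YM (G : FGraph α) (v : α) : FGraph α :=
  (G.LC v).ZM v

/-- `G` is a star graph with centre `c`. -/
def IsStar (G : FGraph α) (c : α) : Prop :=
  c ∈ G.verts ∧
    ∀ a b, G.Adj a b ↔ (a ≠ b ∧ a ∈ G.verts ∧ b ∈ G.verts ∧ (a = c ∨ b = c))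

/-- `G` is a complete graph on its vertex set. -/
def IsComplete (G : FGraph α) : Prop :=
  ∀ a b, G.Adj a b ↔ (a ≠ b ∧ a ∈ G.verts ∧ b ∈ G.verts)

/-- One step of local complementation or vertex deletion. -/
inductive Step : FGraph α → FGraph α → Prop
  | lc (G : FGraph α) (v : α) : Step G (G.LC v)
  | del (G : FGraph α) (v : α) : Step G (G.ZM v)

/-- `H` is a vertex-minor of `G`: `H` is obtained from `G` by a finite sequence of
local complementations and vertex deletions. -/
def IsVertexMinor (H G : FGraph α) : Prop :=
  Relation.ReflTransGen Step G H

/-- One step of local complementation. -/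
inductive LCStep : FGraph α → FGraph α → Prop
  | lc (G : FGraph α) (v : α) : LCStep G (G.LC v)

/-- `H` is obtained from `G` by a finite sequence of local complementations. -/
def LCReach (G H : FGraph α) : Prop :=
  Relation.ReflTransGen LCStep G H

end FGraph

/-- The `n × n` grid graph: vertices `{0,…,n-1} × {0,…,n-1}`, two vertices being
adjacent iff they agree in one coordinate and differ by exactly 1 in the other. -/
def gridGraph (n : ℕ) : FGraph (ℕ × ℕ) where
  verts := {p | p.1 < n ∧ p.2 < n}
  Adj p q := p.1 < n ∧ p.2 < n ∧ q.1 < n ∧ q.2 < n ∧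
    ((p.1 = q.1 ∧ (p.2 + 1 = q.2 ∨ q.2 + 1 = p.2)) ∨
     (p.2 = q.2 ∧ (p.1 + 1 = q.1 ∨ q.1 + 1 = p.1)))
  symm := by
    rintro p q ⟨h1, h2, h3, h4, (⟨he, hd⟩ | ⟨he, hd⟩)⟩
    · exact ⟨h3, h4, h1, h2, Or.inl ⟨he.symm, hd.symm⟩⟩
    · exact ⟨h3, h4, h1, h2, Or.inr ⟨he.symm, hd.symm⟩⟩
  loopless := by
    rintro p ⟨_, _, _, _, (⟨_, hd⟩ | ⟨_, hd⟩)⟩ <;> omega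
  edge_mem := by
    rintro p q ⟨h1, h2, h3, h4, _⟩
    exact ⟨⟨h1, h2⟩, ⟨h3, h4⟩⟩

namespace FGraph

variable {α : Type*}

/-- The induced subgraph of `G` on the vertices of `G` lying in `S`. -/
def restrict (G : FGraph α) (S : Set α) : FGraph α where
  verts := G.verts ∩ S
  Adj a b := G.Adj a b ∧ a ∈ S ∧ b ∈ S
  symm := fun h => ⟨G.symm h.1, h.2.2, h.2.1⟩
  loopless := fun a h => G.loopless a h.1
  edge_mem := fun h => ⟨⟨(G.edge_mem h.1).1, h.2.1⟩, ⟨(G.edge_mem h.1).2, h.2.2⟩⟩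

theorem ext_of_adj {G H : FGraph α} (hv : G.verts = H.verts)
    (ha : ∀ a b, G.Adj a b ↔ H.Adj a b) : G = H := by
  cases G
  cases H
  simp only [FGraph.mk.injEq]
  exact ⟨hv, by funext a b; exact propext (ha a b)⟩

theorem IsVertexMinor.trans {G H K : FGraph α} (h₁ : IsVertexMinor G H)
    (h₂ : IsVertexMinor H K) : IsVertexMinor G K :=
  Relation.ReflTransGen.trans h₂ h₁

theorem isVertexMinor_restrict_compl (G : FGraph α) (D : Finset α) :
    IsVertexMinor (G.restrict (↑D)ᶜ) G := by
  classical
  induction D using Finset.induction_on with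
  | empty =>
    have : G.restrict (↑(∅ : Finset α))ᶜ = G :=
      ext_of_adj (by simp [restrict]) (by simp [restrict])
    rw [this]
    exact Relation.ReflTransGen.refl
  | insert d D _ ih =>
    have : G.restrict (↑(insert d D))ᶜ = (G.restrict (↑D)ᶜ).ZM d :=
      ext_of_adj (by ext x; simp [restrict, ZM]; tauto)
        (by intro a b; simp [restrict, ZM]; tauto)
    rw [this]
    exact ih.tail (Step.del _ _)

theorem isVertexMinor_restrict (G : FGraph α) (hG : G.verts.Finite) (S : Set α) :
    IsVertexMinor (G.restrict S) G := by
  have hfin : (G.verts \ S).Finite := hG.subset Set.sdiff_subset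
  have h := G.isVertexMinor_restrict_compl hfin.toFinset
  have : G.restrict (↑hfin.toFinset)ᶜ = G.restrict S := by
    refine ext_of_adj ?_ ?_
    · ext x
      simp [restrict]
      tauto
    · intro a b
      simp only [restrict, Set.Finite.coe_toFinset, Set.mem_compl_iff, Set.mem_sdiff]
      have := @FGraph.edge_mem _ G a b
      tauto
  rwa [this] at h

theorem IsStar.exists_ncard_eq {G : FGraph α} {c : α} (hG : G.IsStar c) (hfin : G.verts.Finite)
    {N : ℕ} (hN : N + 1 ≤ G.verts.ncard) :
    ∃ H, IsVertexMinor H G ∧ H.IsStar c ∧ H.verts.ncard = N + 1 := by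
  have h1 : N ≤ (G.verts \ {c}).ncard := by
    rw [Set.ncard_sdiff_singleton_of_mem hG.1]
    omega
  obtain ⟨t, ht, htc⟩ := Set.exists_subset_card_eq h1
  have hct : c ∉ t := fun h => (ht h).2 rfl
  have htf : t.Finite := hfin.subset (ht.trans Set.sdiff_subset)
  have hsub : insert c t ⊆ G.verts := Set.insert_subset hG.1 (ht.trans Set.sdiff_subset)
  have hv : (G.restrict (insert c t)).verts = insert c t := Set.inter_eq_right.mpr hsub
  refine ⟨G.restrict (insert c t), G.isVertexMinor_restrict hfin _, ⟨?_, ?_⟩, ?_⟩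
  · rw [hv]
    exact Set.mem_insert _ _
  · intro a b
    rw [hv]
    have ha := @hsub a
    have hb := @hsub b
    simp only [restrict, hG.2 a b]
    tauto
  · rw [hv, Set.ncard_insert_of_notMem hct htf, htc]

theorem isVertexMinor_XM (G : FGraph α) (u w : α) : IsVertexMinor (G.XM u w) G :=
  (((Relation.ReflTransGen.single (Step.lc G w)).tail (Step.lc _ u)).tail
    (Step.del _ u)).tail (Step.lc _ w)

/-- An `X` measurement at a vertex `b` with exactly two, nonadjacent, neighbours `a` and `c`
makes `a` a leaf at `c` and adds the former neighbourhood of `a` to that of `c` modulo two. -/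
theorem XM_adj_iff {G : FGraph α} {a b c : α} (hb : ∀ x, G.Adj b x ↔ x = a ∨ x = c)
    (hac : a ≠ c) (hnac : ¬ G.Adj a c) (x y : α) :
    (G.XM b a).Adj x y ↔ x ≠ b ∧ y ≠ b ∧ x ≠ y ∧
      ((x = a ∧ y = c) ∨ (x = c ∧ y = a) ∨
        (x ≠ a ∧ y ≠ a ∧ ¬(G.Adj x y ↔ (x = c ∧ G.Adj a y) ∨ (y = c ∧ G.Adj a x)))) := by
  have hs : ∀ p q, G.Adj p q ↔ G.Adj q p := fun p q => ⟨G.symm, G.symm⟩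
  have haa := G.loopless a
  have hbb := G.loopless b
  have hba := hb a
  have hbc := hb c
  have hbx := hb x
  have hby := hb y
  have hab := hs a b
  have hne : a ≠ b := by grind
  have hne' : c ≠ b := by grind
  have hax := hs a x
  have hay := hs a y
  have hxb := hs x b
  have hyb := hs y b
  simp only [XM, LC, ZM, Xor']
  grind

/-- If `G` is a tree with root `c` in which the vertices at odd depth (the set `B`) have at most
one child, then `G` has a star on `#B + 1` vertices with centre `c` as a vertex-minor. -/
theorem exists_star_of_tree [DecidableEq α] (c : α) (h : α → ℕ) (m : ℕ) :
    ∀ (G : FGraph α) (A B : Finset α) (par : α → α), A.card = m → c ∉ A → c ∉ B →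
      Disjoint A B → (∀ x, x ∈ G.verts ↔ x = c ∨ x ∈ A ∨ x ∈ B) →
      (∀ a ∈ A, par a ∈ B ∧ h (par a) < h a) →
      (∀ b ∈ B, par b = c ∨ (par b ∈ A ∧ h (par b) < h b)) →
      (∀ a ∈ A, ∀ a' ∈ A, par a = par a' → a = a') →
      (∀ x y, G.Adj x y ↔
        ((x ∈ A ∨ x ∈ B) ∧ par x = y) ∨ ((y ∈ A ∨ y ∈ B) ∧ par y = x)) →
      ∃ H, IsVertexMinor H G ∧ H.IsStar c ∧ H.verts.Finite ∧ H.verts.ncard = B.card + 1 := by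
  induction m with
  | zero =>
    intro G A B par hA hcA hcB _ hV _ hB _ hadj
    obtain rfl := Finset.card_eq_zero.mp hA
    have hverts : G.verts = ↑(insert c B) := by
      ext x
      simp [hV]
    refine ⟨G, Relation.ReflTransGen.refl, ⟨by simp [hV], ?_⟩, ?_, ?_⟩
    · intro x y
      have hx := hB x
      have hy := hB y
      simp only [hadj, hV]
      grind
    · rw [hverts]
      exact Finset.finite_toSet _
    · rw [hverts, Set.ncard_coe_finset, Finset.card_insert_of_notMem hcB]
  | succ m ih =>
    intro G A B par hA hcA hcB hdisj hV hparA hparB hinj hadj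
    have hne : A.Nonempty := by
      rw [← Finset.card_pos]
      omega
    obtain ⟨a, haA, hmin⟩ := Finset.exists_min_image A h hne
    obtain ⟨hbB, hba⟩ := hparA a haA
    have hAB : ∀ x, x ∈ A → x ∉ B := fun x hx => Finset.disjoint_left.mp hdisj hx
    have hbc : par (par a) = c := by
      rcases hparB _ hbB with hc | ⟨h1, h2⟩
      · exact hc
      · have := hmin _ h1
        omega
    have hac : a ≠ c := fun e => hcA (e ▸ haA)
    have hb : ∀ x, G.Adj (par a) x ↔ x = a ∨ x = c := by
      intro x
      have := hparB x
      have := hinj x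
      rw [hadj]
      grind
    have hnac : ¬ G.Adj a c := by
      rw [hadj]
      grind
    have haB : a ∉ B := hAB a haA
    obtain ⟨H, h1, h2, h3, h4⟩ := ih (G.XM (par a) a) (A.erase a) (insert a (B.erase (par a)))
      (fun v => if v = a ∨ par v = a then c else par v)
      (by rw [Finset.card_erase_of_mem haA]; omega)
      (by grind) (by grind)
      (by rw [Finset.disjoint_left]; grind)
      (by
        intro x
        have : x ∈ (G.XM (par a) a).verts ↔ x ∈ G.verts ∧ x ≠ par a := Iff.rfl
        rw [this, hV]
        grind)
      (by
        intro x hx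
        have := hparA x
        have := hinj x
        grind)
      (by
        intro x hx
        have := hparB x
        grind)
      (by
        intro x hx y hy
        have := hparA x
        have := hparA y
        have := hinj x
        grind)
      (by
        intro x y
        rw [XM_adj_iff hb hac hnac]
        have hnbr : ∀ y, y ≠ par a → (G.Adj a y ↔ y ∈ B ∧ par y = a) := by
          intro y hy
          have := hparA y
          rw [hadj]
          grind
        have hx₁ := hnbr x
        have hy₁ := hnbr y
        have hx₂ := hparA x
        have hy₂ := hparA y
        have hx₃ := hparB x
        have hy₃ := hparB y
        have hx₄ := hinj x
        have hy₄ := hinj y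
        have hx₅ := hAB x
        have hy₅ := hAB y
        have hxy := hadj x y
        by_cases hxb : x = par a
        · grind
        by_cases hyb : y = par a
        · grind
        by_cases hxa : x = a
        · grind
        by_cases hya : y = a
        · grind
        have hx₆ := hx₁ hxb
        have hy₆ := hy₁ hyb
        clear hnbr hx₁ hy₁ hb ih hadj hmin hparA hparB hV
        by_cases hxc : x = c <;> by_cases hyc : y = c
        · grind
        · grind
        · grind
        · grind)
    refine ⟨H, h1.trans (G.isVertexMinor_XM _ _), h2, h3, ?_⟩
    rw [h4, Finset.card_insert_of_notMem (by grind), Finset.card_erase_of_mem hbB]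
    have := Finset.card_pos.mpr ⟨_, hbB⟩
    omega

end FGraph

theorem gridGraph_verts_finite (n : ℕ) : (gridGraph n).verts.Finite := by
  refine ((Finset.range n ×ˢ Finset.range n).finite_toSet).subset ?_
  rintro ⟨x, y⟩ h
  simpa [gridGraph] using h

/-- A nonempty finite tree in the grid with root `c`, nonroot even-depth vertices `A` and
odd-depth vertices `B` with at most one child each yields a star on `#B + 1` vertices. -/
theorem gridGraph_exists_star {n : ℕ} {c : ℕ × ℕ} {A B : Finset (ℕ × ℕ)}
    {par : ℕ × ℕ → ℕ × ℕ} {h : ℕ × ℕ → ℕ} (hcA : c ∉ A) (hcB : c ∉ B) (hAB : Disjoint A B)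
    (hc : c ∈ (gridGraph n).verts) (hA : ∀ a ∈ A, par a ∈ B ∧ h (par a) < h a)
    (hB : ∀ b ∈ B, par b = c ∨ (par b ∈ A ∧ h (par b) < h b))
    (hinj : ∀ a ∈ A, ∀ a' ∈ A, par a = par a' → a = a')
    (hpar : ∀ x, x ∈ A ∨ x ∈ B → (gridGraph n).Adj x (par x))
    (hadj : ∀ x, x = c ∨ x ∈ A ∨ x ∈ B → ∀ y, y = c ∨ y ∈ A ∨ y ∈ B → (gridGraph n).Adj x y →
      ((x ∈ A ∨ x ∈ B) ∧ par x = y) ∨ ((y ∈ A ∨ y ∈ B) ∧ par y = x)) :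
    ∃ H, FGraph.IsVertexMinor H (gridGraph n) ∧ H.IsStar c ∧ H.verts.Finite ∧
      H.verts.ncard = B.card + 1 := by
  have hmem : ∀ x, x ∈ A ∨ x ∈ B → par x = c ∨ par x ∈ A ∨ par x ∈ B := by
    intro x hx
    have := hA x
    have := hB x
    tauto
  obtain ⟨H, h1, h2⟩ := FGraph.exists_star_of_tree c h A.card
    ((gridGraph n).restrict {x | x = c ∨ x ∈ A ∨ x ∈ B}) A B par rfl hcA hcB hAB
    (by
      intro x
      refine ⟨fun hx => hx.2, fun hx => ⟨?_, hx⟩⟩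
      rcases hx with rfl | hx
      · exact hc
      · exact ((gridGraph n).edge_mem (hpar x hx)).1)
    hA hB hinj
    (by
      intro x y
      constructor
      · rintro ⟨h1, hx, hy⟩
        exact hadj x hx y hy h1
      · rintro (⟨hx, rfl⟩ | ⟨hy, rfl⟩)
        · exact ⟨hpar x hx, Or.inr hx, hmem x hx⟩
        · exact ⟨(gridGraph n).symm (hpar y hy), hmem y hy, Or.inr hy⟩)
  exact ⟨H, h1.trans (FGraph.isVertexMinor_restrict _ (gridGraph_verts_finite n) _), h2⟩

/-- Parent of a vertex in the comb tree with root `(1, 0)`, whose teeth are the rows with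
index congruent to `1` modulo `3`. -/
def combParent (p : ℕ × ℕ) : ℕ × ℕ :=
  if p.1 % 3 = 0 ∧ (p.1 = 0 ∨ (1 ≤ p.2 ∧ ¬(p.1 % 6 = 3 ∧ p.2 = 1))) then (p.1 + 1, p.2)
  else if p.1 % 6 = 3 ∧ p.2 = 1 then (p.1, 0)
  else if p.1 % 6 = 5 ∧ p.2 = 0 then (p.1, 1)
  else if p.2 = 0 ∨ p.1 % 3 = 2 ∨ (p.1 % 6 = 4 ∧ p.2 = 1) then (p.1 - 1, p.2)
  else (p.1, p.2 - 1)

/-- A function that decreases along `combParent`. -/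
def combRank (p : ℕ × ℕ) : ℕ :=
  if p.1 % 6 = 5 ∧ p.2 = 0 then 3 * p.1 + 2
  else if p.1 % 3 = 0 ∧ (p.1 = 0 ∨ (1 ≤ p.2 ∧ ¬(p.1 % 6 = 3 ∧ p.2 = 1))) then 3 * p.1 + p.2 + 4
  else 3 * p.1 + p.2

theorem combRank_cases (x y : ℕ) :
    (x % 6 = 5 ∧ y = 0 ∧ combRank (x, y) = 3 * x + 2) ∨
    (x % 3 = 0 ∧ (x = 0 ∨ (1 ≤ y ∧ ¬(x % 6 = 3 ∧ y = 1))) ∧ combRank (x, y) = 3 * x + y + 4) ∨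
    (¬(x % 6 = 5 ∧ y = 0) ∧ ¬(x % 3 = 0 ∧ (x = 0 ∨ (1 ≤ y ∧ ¬(x % 6 = 3 ∧ y = 1)))) ∧
      combRank (x, y) = 3 * x + y) := by
  simp only [combRank]
  split_ifs <;> omega

/-- The vertices of the comb tree at positive even depth. -/
def combEven (n : ℕ) : Finset (ℕ × ℕ) :=
  (Finset.range n ×ˢ Finset.range n).filter fun p =>
    (p.1 + p.2) % 2 = 1 ∧ (p.2 = 0 ∨ p.1 % 3 = 1) ∧ ¬(p.1 = 1 ∧ p.2 = 0)

/-- The vertices of the comb tree at odd depth. -/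
def combOdd (n : ℕ) : Finset (ℕ × ℕ) :=
  (Finset.range n ×ˢ Finset.range n).filter fun p =>
    (p.1 + p.2) % 2 = 0 ∧ ¬(p.2 = 0 ∧ p.1 % 3 = 1) ∧ (p.1 % 3 ≠ 0 ∨ p.1 + 1 < n)

theorem mem_combEven {n x y : ℕ} : (x, y) ∈ combEven n ↔
    (x < n ∧ y < n) ∧ (x + y) % 2 = 1 ∧ (y = 0 ∨ x % 3 = 1) ∧ ¬(x = 1 ∧ y = 0) := by
  simp only [combEven, Finset.mem_filter, Finset.mem_product, Finset.mem_range]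

theorem mem_combOdd {n x y : ℕ} : (x, y) ∈ combOdd n ↔
    (x < n ∧ y < n) ∧ (x + y) % 2 = 0 ∧ ¬(y = 0 ∧ x % 3 = 1) ∧ (x % 3 ≠ 0 ∨ x + 1 < n) := by
  simp only [combOdd, Finset.mem_filter, Finset.mem_product, Finset.mem_range]

theorem combParent_eq_succ_left {x y : ℕ}
    (h : x % 3 = 0 ∧ (x = 0 ∨ (1 ≤ y ∧ ¬(x % 6 = 3 ∧ y = 1)))) :
    combParent (x, y) = (x + 1, y) :=
  if_pos h

theorem combParent_eq_zero {x : ℕ} (h : x % 6 = 3) : combParent (x, 1) = (x, 0) := by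
  dsimp only [combParent]
  rw [if_neg (by omega), if_pos (by omega)]

theorem combParent_eq_one {x : ℕ} (h : x % 6 = 5) : combParent (x, 0) = (x, 1) := by
  dsimp only [combParent]
  rw [if_neg (by omega), if_neg (by omega), if_pos (by omega)]

theorem combParent_eq_pred_left {x y : ℕ} (hx : 1 ≤ x)
    (h1 : ¬(x % 6 = 5 ∧ y = 0)) (h2 : y = 0 ∨ x % 3 = 2 ∨ (x % 6 = 4 ∧ y = 1)) :
    combParent (x, y) = (x - 1, y) := by
  dsimp only [combParent]
  rw [if_neg (by omega), if_neg (by omega), if_neg (by omega), if_pos (by omega)]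

theorem combParent_eq_pred_right {x y : ℕ} (hx : x % 3 = 1) (hy : 1 ≤ y)
    (h : ¬(x % 6 = 4 ∧ y = 1)) : combParent (x, y) = (x, y - 1) := by
  dsimp only [combParent]
  rw [if_neg (by omega), if_neg (by omega), if_neg (by omega), if_neg (by omega)]

theorem combParent_cases_of_mem_combEven {n x y : ℕ} (h : (x, y) ∈ combEven n) :
    (x % 6 = 5 ∧ y = 0 ∧ combParent (x, y) = (x, 1)) ∨
    ((x % 6 = 1 ∨ x % 6 = 3) ∧ y = 0 ∧ combParent (x, y) = (x - 1, 0)) ∨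
    (x % 6 = 4 ∧ y = 1 ∧ combParent (x, y) = (x - 1, 1)) ∨
    (x % 3 = 1 ∧ 2 ≤ y ∧ combParent (x, y) = (x, y - 1)) := by
  rw [mem_combEven] at h
  have hc : (x % 6 = 5 ∧ y = 0) ∨ ((x % 6 = 1 ∨ x % 6 = 3) ∧ y = 0) ∨ (x % 6 = 4 ∧ y = 1) ∨
      (x % 3 = 1 ∧ 2 ≤ y) := by omega
  rcases hc with ⟨hx, rfl⟩ | ⟨hx, rfl⟩ | ⟨hx, rfl⟩ | ⟨hx, hy⟩
  · exact Or.inl ⟨hx, rfl, combParent_eq_one hx⟩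
  · exact Or.inr (Or.inl ⟨hx, rfl,
      combParent_eq_pred_left (by omega) (by omega) (by omega)⟩)
  · exact Or.inr (Or.inr (Or.inl ⟨hx, rfl,
      combParent_eq_pred_left (by omega) (by omega) (by omega)⟩))
  · exact Or.inr (Or.inr (Or.inr ⟨hx, hy, combParent_eq_pred_right hx (by omega) (by omega)⟩))

theorem combParent_cases_of_mem_combOdd {n x y : ℕ} (h : (x, y) ∈ combOdd n) :
    (x % 3 = 0 ∧ (x = 0 ∨ (1 ≤ y ∧ ¬(x % 6 = 3 ∧ y = 1))) ∧ combParent (x, y) = (x + 1, y)) ∨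
    (x % 6 = 3 ∧ y = 1 ∧ combParent (x, y) = (x, 0)) ∨
    ((x % 3 = 2 ∨ (1 ≤ x ∧ x % 6 = 0)) ∧ (x % 3 = 2 ∨ y = 0) ∧
      combParent (x, y) = (x - 1, y)) ∨
    (x % 3 = 1 ∧ 1 ≤ y ∧ combParent (x, y) = (x, y - 1)) := by
  rw [mem_combOdd] at h
  have hc : (x % 3 = 0 ∧ (x = 0 ∨ (1 ≤ y ∧ ¬(x % 6 = 3 ∧ y = 1)))) ∨ (x % 6 = 3 ∧ y = 1) ∨
      ((x % 3 = 2 ∨ (1 ≤ x ∧ x % 6 = 0)) ∧ (x % 3 = 2 ∨ y = 0)) ∨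
      (x % 3 = 1 ∧ 1 ≤ y) := by omega
  rcases hc with hx | ⟨hx, rfl⟩ | ⟨hx, hy⟩ | ⟨hx, hy⟩
  · exact Or.inl ⟨hx.1, hx.2, combParent_eq_succ_left hx⟩
  · exact Or.inr (Or.inl ⟨hx, rfl, combParent_eq_zero hx⟩)
  · exact Or.inr (Or.inr (Or.inl ⟨hx, hy,
      combParent_eq_pred_left (by omega) (by omega) (by omega)⟩))
  · exact Or.inr (Or.inr (Or.inr ⟨hx, hy, combParent_eq_pred_right hx hy (by omega)⟩))

theorem combParent_mem_combOdd {n : ℕ} (hn : 2 ≤ n) : ∀ a ∈ combEven n,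
    combParent a ∈ combOdd n ∧ combRank (combParent a) < combRank a := by
  rintro ⟨x, y⟩ h
  have hr := combRank_cases x y
  have hc := combParent_cases_of_mem_combEven h
  rw [mem_combEven] at h
  rcases hc with hc | hc | hc | hc <;> rw [hc.2.2, mem_combOdd]
  · have := combRank_cases x 1
    exact ⟨by omega, by omega⟩
  · have := combRank_cases (x - 1) 0
    exact ⟨by omega, by omega⟩
  · have := combRank_cases (x - 1) 1
    exact ⟨by omega, by omega⟩
  · have := combRank_cases x (y - 1)
    exact ⟨by omega, by omega⟩

theorem combParent_mem_combEven {n : ℕ} : ∀ b ∈ combOdd n, combParent b = (1, 0) ∨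
    (combParent b ∈ combEven n ∧ combRank (combParent b) < combRank b) := by
  rintro ⟨x, y⟩ h
  have hr := combRank_cases x y
  have hc := combParent_cases_of_mem_combOdd h
  rw [mem_combOdd] at h
  rcases hc with hc | hc | hc | hc <;>
    rw [hc.2.2, mem_combEven, Prod.mk.injEq, or_iff_not_imp_left] <;> intro hne
  · have := combRank_cases (x + 1) y
    exact ⟨by omega, by omega⟩
  · have := combRank_cases x 0
    exact ⟨by omega, by omega⟩
  · have := combRank_cases (x - 1) y
    exact ⟨by omega, by omega⟩
  · have := combRank_cases x (y - 1)
    exact ⟨by omega, by omega⟩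

theorem combParent_injOn {n : ℕ} : ∀ a ∈ combEven n, ∀ a' ∈ combEven n,
    combParent a = combParent a' → a = a' := by
  rintro ⟨x, y⟩ h1 ⟨x', y'⟩ h2 he
  rw [Prod.mk.injEq]
  rcases combParent_cases_of_mem_combEven h1 with h | h | h | h <;>
  rcases combParent_cases_of_mem_combEven h2 with h' | h' | h' | h' <;>
  · rw [h.2.2, h'.2.2, Prod.mk.injEq] at he
    rw [mem_combEven] at h1 h2
    omega

theorem gridGraph_adj_iff {n x y x' y' : ℕ} : (gridGraph n).Adj (x, y) (x', y') ↔
    x < n ∧ y < n ∧ x' < n ∧ y' < n ∧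
      ((x = x' ∧ (y + 1 = y' ∨ y' + 1 = y)) ∨ (y = y' ∧ (x + 1 = x' ∨ x' + 1 = x))) :=
  Iff.rfl

theorem gridGraph_adj_combParent {n : ℕ} (hn : 2 ≤ n) (p : ℕ × ℕ)
    (hp : p ∈ combEven n ∨ p ∈ combOdd n) : (gridGraph n).Adj p (combParent p) := by
  obtain ⟨x, y⟩ := p
  rw [mem_combEven, mem_combOdd] at hp
  simp only [combParent]
  split_ifs <;> rw [gridGraph_adj_iff] <;> omega

theorem mem_comb_iff {n x y : ℕ} (hn : 2 ≤ n) :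
    ((x, y) = (1, 0) ∨ (x, y) ∈ combEven n ∨ (x, y) ∈ combOdd n) ↔
      (x < n ∧ y < n) ∧ (((x + y) % 2 = 1 ∧ (y = 0 ∨ x % 3 = 1)) ∨
        ((x + y) % 2 = 0 ∧ ¬(y = 0 ∧ x % 3 = 1) ∧ (x % 3 ≠ 0 ∨ x + 1 < n))) := by
  rw [mem_combEven, mem_combOdd, Prod.mk.injEq]
  omega

theorem combParent_horizontal {n x y : ℕ} (hn : 2 ≤ n)
    (hp : (x, y) = (1, 0) ∨ (x, y) ∈ combEven n ∨ (x, y) ∈ combOdd n)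
    (hq : (x, y + 1) = (1, 0) ∨ (x, y + 1) ∈ combEven n ∨ (x, y + 1) ∈ combOdd n) :
    ((x, y) ≠ (1, 0) ∧ combParent (x, y) = (x, y + 1)) ∨
      ((x, y + 1) ≠ (1, 0) ∧ combParent (x, y + 1) = (x, y)) := by
  rw [mem_comb_iff hn] at hp hq
  by_cases h : x % 6 = 5 ∧ y = 0
  · obtain ⟨hx, rfl⟩ := h
    refine Or.inl ⟨?_, combParent_eq_one hx⟩
    rw [ne_eq, Prod.mk.injEq]
    omega
  · refine Or.inr ⟨by simp, ?_⟩
    have hc : (x % 6 = 3 ∧ y = 0) ∨ (x % 3 = 1 ∧ ¬(x % 6 = 4 ∧ y + 1 = 1)) := by omega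
    rcases hc with ⟨hx, rfl⟩ | ⟨hx, hy⟩
    · exact combParent_eq_zero hx
    · exact combParent_eq_pred_right hx (by omega) hy

theorem combParent_vertical {n x y : ℕ} (hn : 2 ≤ n)
    (hp : (x, y) = (1, 0) ∨ (x, y) ∈ combEven n ∨ (x, y) ∈ combOdd n)
    (hq : (x + 1, y) = (1, 0) ∨ (x + 1, y) ∈ combEven n ∨ (x + 1, y) ∈ combOdd n) :
    ((x, y) ≠ (1, 0) ∧ combParent (x, y) = (x + 1, y)) ∨
      ((x + 1, y) ≠ (1, 0) ∧ combParent (x + 1, y) = (x, y)) := by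
  rw [mem_comb_iff hn] at hp hq
  have hxy (x' : ℕ) : (x', y) ≠ (1, 0) ↔ ¬(x' = 1 ∧ y = 0) := by rw [ne_eq, Prod.mk.injEq]
  rw [hxy, hxy]
  by_cases h : x % 3 = 0 ∧ (x = 0 ∨ (1 ≤ y ∧ ¬(x % 6 = 3 ∧ y = 1)))
  · exact Or.inl ⟨by omega, combParent_eq_succ_left h⟩
  · exact Or.inr ⟨by omega,
      combParent_eq_pred_left (by omega) (by omega) (by omega)⟩

theorem combParent_of_adj {n : ℕ} (hn : 2 ≤ n) (p : ℕ × ℕ)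
    (hp : p = (1, 0) ∨ p ∈ combEven n ∨ p ∈ combOdd n)
    (q : ℕ × ℕ) (hq : q = (1, 0) ∨ q ∈ combEven n ∨ q ∈ combOdd n) (h : (gridGraph n).Adj p q) :
    ((p ∈ combEven n ∨ p ∈ combOdd n) ∧ combParent p = q) ∨
      ((q ∈ combEven n ∨ q ∈ combOdd n) ∧ combParent q = p) := by
  obtain ⟨x, y⟩ := p
  obtain ⟨x', y'⟩ := q
  obtain ⟨-, -, -, -, ⟨hx, hy | hy⟩ | ⟨hy, hx | hx⟩⟩ := gridGraph_adj_iff.mp h <;>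
    subst hx <;> subst hy
  · have := combParent_horizontal hn hp hq
    tauto
  · have := combParent_horizontal hn hq hp
    tauto
  · have := combParent_vertical hn hp hq
    tauto
  · have := combParent_vertical hn hq hp
    tauto

theorem gridGraph_exists_star_comb {n : ℕ} (hn : 2 ≤ n) :
    ∃ H, FGraph.IsVertexMinor H (gridGraph n) ∧ H.IsStar (1, 0) ∧ H.verts.Finite ∧
      H.verts.ncard = (combOdd n).card + 1 := by
  refine gridGraph_exists_star (A := combEven n) (par := combParent) (h := combRank)
    ?_ ?_ ?_ ?_ ?_ ?_ ?_ ?_ ?_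
  · simp [mem_combEven]
  · simp [mem_combOdd]
  · rw [Finset.disjoint_left]
    rintro ⟨x, y⟩ h1 h2
    rw [mem_combEven] at h1
    rw [mem_combOdd] at h2
    omega
  · simp only [gridGraph, Set.mem_ofPred_eq]
    omega
  · exact combParent_mem_combOdd hn
  · exact combParent_mem_combEven
  · exact combParent_injOn
  · exact gridGraph_adj_combParent hn
  · exact combParent_of_adj hn

theorem le_card_combOdd {k : ℕ} (hk : 4 ≤ k) : 6 * k ^ 2 + 7 * k ≤ (combOdd (4 * k + 1)).card := by
  have hcard : 6 * k ^ 2 + 7 * k ≤ (Finset.range (4 * k) ×ˢ Finset.range (2 * k)).card := by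
    rw [Finset.card_product, Finset.card_range, Finset.card_range]
    nlinarith
  refine hcard.trans (Finset.card_le_card_of_injOn
    (fun p => (p.1, 2 * p.2 + 2 - p.1 % 2)) ?_ ?_)
  · rintro ⟨x, j⟩ h
    simp only [Finset.coe_product, Finset.coe_range, Set.mem_prod, Set.mem_Iio] at h
    simp only [Finset.mem_coe, mem_combOdd]
    omega
  · rintro ⟨x, j⟩ - ⟨x', j'⟩ - he
    simp only [Prod.mk.injEq] at he ⊢
    obtain ⟨rfl, he⟩ := he
    omega

instance gridGraph_decidableAdj (n : ℕ) (p q : ℕ × ℕ) : Decidable ((gridGraph n).Adj p q) :=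
  inferInstanceAs (Decidable (p.1 < n ∧ p.2 < n ∧ q.1 < n ∧ q.2 < n ∧
    ((p.1 = q.1 ∧ (p.2 + 1 = q.2 ∨ q.2 + 1 = p.2)) ∨
     (p.2 = q.2 ∧ (p.1 + 1 = q.1 ∨ q.1 + 1 = p.1)))))

/-- The vertices at positive even depth in a tree rooted at `(0, 1)` that arises from the
`5 × 5` grid by vertex deletions and a pivot on the edge between `(1, 1)` and `(1, 2)`. -/
def fiveEven : Finset (ℕ × ℕ) := {(0, 3), (3, 0), (3, 2), (3, 4)}

/-- The vertices at odd depth in that tree. -/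
def fiveOdd : Finset (ℕ × ℕ) :=
  {(0, 0), (1, 2), (1, 3), (2, 2), (0, 2), (0, 4), (4, 2), (3, 1), (3, 3), (2, 0), (4, 0), (2, 4),
    (4, 4)}

/-- Parent of a vertex in that tree. -/
def fiveParent (p : ℕ × ℕ) : ℕ × ℕ :=
  if p = (0, 3) then (1, 3)
  else if p = (0, 2) ∨ p = (0, 4) then (0, 3)
  else if p = (3, 2) then (2, 2)
  else if p = (4, 2) ∨ p = (3, 1) ∨ p = (3, 3) then (3, 2)
  else if p = (3, 0) then (3, 1)
  else if p = (2, 0) ∨ p = (4, 0) then (3, 0)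
  else if p = (3, 4) then (3, 3)
  else if p = (2, 4) ∨ p = (4, 4) then (3, 4)
  else (0, 1)

/-- A function that decreases along `fiveParent` away from the root. -/
def fiveRank (p : ℕ × ℕ) : ℕ :=
  if p ∈ ({(1, 3), (2, 2)} : Finset (ℕ × ℕ)) then 1
  else if p ∈ ({(0, 3), (3, 2)} : Finset (ℕ × ℕ)) then 2
  else if p ∈ ({(3, 1), (3, 3)} : Finset (ℕ × ℕ)) then 3
  else if p ∈ ({(3, 0), (3, 4)} : Finset (ℕ × ℕ)) then 4
  else 5

/-- The vertices of the `5 × 5` grid that are kept before the pivot. -/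
def fiveVerts : Finset (ℕ × ℕ) := insert (0, 1) (insert (1, 1) (fiveEven ∪ fiveOdd))

theorem gridGraph_exists_star_five :
    ∃ (H : FGraph (ℕ × ℕ)) (c : ℕ × ℕ),
      FGraph.IsVertexMinor H (gridGraph 5) ∧ H.IsStar c ∧ H.verts.Finite ∧ H.verts.ncard = 14 := by
  have hvert : ∀ x ∈ fiveVerts, x.1 < 5 ∧ x.2 < 5 := by decide +kernel
  have hnbr : ∀ x ∈ fiveVerts, (gridGraph 5).Adj (1, 1) x ↔ x = (1, 2) ∨ x = (0, 1) := by
    decide +kernel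
  have hb : ∀ x, ((gridGraph 5).restrict fiveVerts).Adj (1, 1) x ↔ x = (1, 2) ∨ x = (0, 1) := by
    intro x
    have hx : x = (1, 2) ∨ x = (0, 1) → x ∈ fiveVerts := by
      rintro (rfl | rfl) <;> decide +kernel
    exact ⟨fun h => (hnbr x h.2.2).mp h.1,
      fun h => ⟨(hnbr x (hx h)).mpr h, by decide +kernel, hx h⟩⟩
  have hnac : ¬((gridGraph 5).restrict fiveVerts).Adj (1, 2) (0, 1) := fun h =>
    absurd h.1 (by decide +kernel)
  have hXM := FGraph.XM_adj_iff hb (by decide) hnac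
  have htree : ∀ x ∈ fiveVerts, ∀ y ∈ fiveVerts,
      (x ≠ (1, 1) ∧ y ≠ (1, 1) ∧ x ≠ y ∧
        ((x = (1, 2) ∧ y = (0, 1)) ∨ (x = (0, 1) ∧ y = (1, 2)) ∨ (x ≠ (1, 2) ∧ y ≠ (1, 2) ∧
          ¬((gridGraph 5).Adj x y ↔ (x = (0, 1) ∧ (gridGraph 5).Adj (1, 2) y) ∨
            (y = (0, 1) ∧ (gridGraph 5).Adj (1, 2) x))))) ↔
      ((x ∈ fiveEven ∨ x ∈ fiveOdd) ∧ fiveParent x = y) ∨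
        ((y ∈ fiveEven ∨ y ∈ fiveOdd) ∧ fiveParent y = x) := by
    decide +kernel
  have hmem : ∀ x, x ∈ fiveEven ∨ x ∈ fiveOdd → x ∈ fiveVerts := by
    intro x hx
    simp only [fiveVerts, Finset.mem_insert, Finset.mem_union]
    tauto
  have hpar : ∀ x ∈ fiveVerts, fiveParent x ∈ fiveVerts := by decide +kernel
  have h12 : ((1, 2) : ℕ × ℕ) ∈ fiveVerts := by decide +kernel
  obtain ⟨H, h1, h2, h3, h4⟩ := FGraph.exists_star_of_tree (0, 1) fiveRank 4
    (((gridGraph 5).restrict fiveVerts).XM (1, 1) (1, 2)) fiveEven fiveOdd fiveParent rfl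
    (by decide +kernel) (by decide +kernel) (by decide +kernel)
    (by
      have hne : ∀ x, x = (0, 1) ∨ x ∈ fiveEven ∨ x ∈ fiveOdd → x ≠ (1, 1) := by
        rintro x h rfl
        exact absurd h (by decide +kernel)
      intro x
      change ((x.1 < 5 ∧ x.2 < 5) ∧ x ∈ fiveVerts) ∧ x ≠ (1, 1) ↔ _
      have h1 := hvert x
      have h2 := hne x
      simp only [fiveVerts, Finset.mem_insert, Finset.mem_union] at h1 ⊢
      tauto)
    (by decide +kernel) (by decide +kernel) (by decide +kernel)
    (by
      intro x y
      by_cases hxy : x ∈ fiveVerts ∧ y ∈ fiveVerts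
      · obtain ⟨hx, hy⟩ := hxy
        rw [hXM, ← htree x hx y hy]
        simp only [FGraph.restrict, Finset.mem_coe, hx, hy, h12, and_true]
      · refine iff_of_false (fun h => hxy ?_) ?_
        · have h' := FGraph.edge_mem _ h
          exact ⟨h'.1.1.2, h'.2.1.2⟩
        · rintro (⟨h, rfl⟩ | ⟨h, rfl⟩)
          · exact hxy ⟨hmem _ h, hpar _ (hmem _ h)⟩
          · exact hxy ⟨hpar _ (hmem _ h), hmem _ h⟩)
  exact ⟨H, (0, 1), h1.trans ((FGraph.isVertexMinor_XM _ _ _).trans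
    (FGraph.isVertexMinor_restrict _ (gridGraph_verts_finite 5) _)), h2, h3, h4⟩

theorem gridGraph_one_isStar : (gridGraph 1).IsStar (0, 0) := by
  refine ⟨by simp [gridGraph], ?_⟩
  rintro ⟨x, y⟩ ⟨x', y'⟩
  simp only [gridGraph, ne_eq, Prod.mk.injEq, Set.mem_ofPred_eq]
  omega

/-- for `n = 4k + 1` (`k ≥ 0`), the star graph on 6 * k ^ 2 + 7 * k + 1 vertices is a
vertex-minor of the `n × n` grid graph. -/
theorem grid_star_vertexMinor_16 (k n : ℕ)  (hn : n = 4 * k + 1) :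
    ∃ (H : FGraph (ℕ × ℕ)) (c : ℕ × ℕ),
      FGraph.IsVertexMinor H (gridGraph n) ∧ H.IsStar c ∧
      H.verts.ncard = 6 * k ^ 2 + 7 * k + 1 := by
  have key : ∃ (H : FGraph (ℕ × ℕ)) (c : ℕ × ℕ), FGraph.IsVertexMinor H (gridGraph n) ∧
      H.IsStar c ∧ H.verts.Finite ∧ 6 * k ^ 2 + 7 * k + 1 ≤ H.verts.ncard := by
    subst hn
    rcases Nat.eq_zero_or_pos k with rfl | hk
    · have hfin := gridGraph_verts_finite 1
      exact ⟨gridGraph 1, (0, 0), Relation.ReflTransGen.refl, gridGraph_one_isStar, hfin,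
        (Set.ncard_pos hfin).mpr ⟨_, gridGraph_one_isStar.1⟩⟩
    rcases eq_or_ne k 1 with rfl | hk1
    · obtain ⟨H, c, h1, h2, h3, h4⟩ := gridGraph_exists_star_five
      exact ⟨H, c, h1, h2, h3, h4.ge⟩
    · obtain ⟨H, h1, h2, h3, h4⟩ := gridGraph_exists_star_comb (n := 4 * k + 1) (by omega)
      refine ⟨H, (1, 0), h1, h2, h3, ?_⟩
      rw [h4, Nat.add_le_add_iff_right]
      rcases lt_or_ge k 4 with hk4 | hk4
      · interval_cases k
        · exact absurd rfl hk1
        · decide +kernel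
        · decide +kernel
      · exact le_card_combOdd hk4
  obtain ⟨H, c, h1, h2, h3, h4⟩ := key
  obtain ⟨K, h5, h6, h7⟩ := h2.exists_ncard_eq h3 h4
  exact ⟨K, c, h5.trans h1, h6, h7⟩
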